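/- arXiv:2504.16744 — 2 statements merged into one kernel-verified Lean document; each statement's English description precedes it below -/
import Mathlib

section
/- Let G=(V,E) be a digraph with positive capacities cap and α ∈ (0,1) rational. Let O be an optimal feasible MMCFS solution for (G,cap,α) and A a feasible MMCFS solution with A ≠ O. Then A∖O is nonempty and both of the following inequalities hold: |A| ≤ (1 + (1−α)/(2α)) · (mc(O)/mc(A)) · |O|, and |A| ≤ |O| + ((1−α)/(2α)) · (mc(O)/mc(A∖O)) · |O|. -/
open Finset

variable {V : Type*}

/-- A flow for the commodity `(s,t)` of value `d`, supported on the edge set `E`. -/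
def IsFlow [Fintype V] [DecidableEq V] (E : Finset (V × V)) (s t : V) (d : ℚ)
    (f : V × V → ℚ) : Prop :=
  (∀ e, 0 ≤ f e) ∧ (∀ e, e ∉ E → f e = 0) ∧
    ∀ v : V,
      ((∑ e ∈ E.filter (fun e => e.2 = v), f e) -
          ∑ e ∈ E.filter (fun e => e.1 = v), f e) =
        (if v = t then d else 0) - (if v = s then d else 0)

/-- The traffic matrix `T` is routable in the edge set `A ⊆ E` via a multi-commodity flow. -/
def Routable [Fintype V] [DecidableEq V] (E : Finset (V × V)) (cap : V × V → ℚ)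
    (T : V × V → ℚ) (A : Finset (V × V)) : Prop :=
  ∃ f : V × V → V × V → ℚ,
    (∀ p : V × V, IsFlow E p.1 p.2 (T p) (f p)) ∧
    (∀ e ∈ E, (∑ p : V × V, f p e) ≤ cap e) ∧
    (∀ e ∈ E, e ∉ A → (∑ p : V × V, f p e) = 0)

/-- The traffic matrix `T_E` demanding `cap e` for each edge `e ∈ E` and `0` otherwise. -/
def trafficTE [Fintype V] [DecidableEq V] (E : Finset (V × V)) (cap : V × V → ℚ) :
    V × V → ℚ := fun p => if p ∈ E then cap p else 0

/-- A traffic matrix is a nonnegative function on pairs of vertices. -/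
def IsTrafficMatrix (T : V × V → ℚ) : Prop := ∀ p, 0 ≤ T p

/-- `A ⊆ E` is a feasible MMCFS solution: every traffic matrix routable in `E`
remains routable in `A` after scaling by `α`. -/
def MMCFSFeasible [Fintype V] [DecidableEq V] (E : Finset (V × V)) (cap : V × V → ℚ)
    (α : ℚ) (A : Finset (V × V)) : Prop :=
  A ⊆ E ∧ ∀ T : V × V → ℚ, IsTrafficMatrix T → Routable E cap T E →
    Routable E cap (fun p => α * T p) A

/-- The mean capacity of a finite set of edges. -/
def meanCap (cap : V × V → ℚ) (S : Finset (V × V)) : ℚ := (∑ e ∈ S, cap e) / S.card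

section

variable [Fintype V] [DecidableEq V] {E : Finset (V × V)} {cap : V × V → ℚ}

lemma IsFlow.sum_nonneg {s t : V} {d : ℚ} {f : V × V → ℚ}
    (hf : IsFlow E s t d f) (S : Finset (V × V)) : 0 ≤ ∑ e ∈ S, f e :=
  Finset.sum_nonneg fun e _ => hf.1 e

lemma IsFlow.le_sum_into_target {s t : V} {d : ℚ} {f : V × V → ℚ}
    (hf : IsFlow E s t d f) (hst : s ≠ t) :
    d ≤ ∑ e ∈ E.filter (fun e => e.2 = t), f e := by
  have h := hf.2.2 t
  rw [if_pos rfl, if_neg hst.symm] at h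
  have := hf.sum_nonneg (E.filter fun e => e.1 = t)
  linarith

lemma IsFlow.le_sum_out_of_source {s t : V} {d : ℚ} {f : V × V → ℚ}
    (hf : IsFlow E s t d f) (hst : s ≠ t) :
    d ≤ ∑ e ∈ E.filter (fun e => e.1 = s), f e := by
  have h := hf.2.2 s
  rw [if_neg hst, if_pos rfl] at h
  have := hf.sum_nonneg (E.filter fun e => e.2 = s)
  linarith

lemma IsFlow.le_sum {s t : V} {d : ℚ} {f : V × V → ℚ}
    (hf : IsFlow E s t d f) (hst : s ≠ t) : d ≤ ∑ e ∈ E, f e :=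
  (hf.le_sum_into_target hst).trans
    (Finset.sum_le_sum_of_subset_of_nonneg (Finset.filter_subset _ _) fun e _ _ => hf.1 e)

/-- A flow avoiding the direct edge uses at least two units of capacity per unit of value. -/
lemma IsFlow.two_mul_le_sum {s t : V} {d : ℚ} {f : V × V → ℚ}
    (hf : IsFlow E s t d f) (hst : s ≠ t) (h0 : f (s, t) = 0) :
    2 * d ≤ ∑ e ∈ E, f e := by
  have hin := hf.le_sum_into_target hst
  have hout := hf.le_sum_out_of_source hst
  rw [Finset.sum_filter] at hin hout
  have hle : (∑ e ∈ E, if e.2 = t then f e else 0) + (∑ e ∈ E, if e.1 = s then f e else 0)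
      ≤ ∑ e ∈ E, f e := by
    rw [← Finset.sum_add_distrib]
    refine Finset.sum_le_sum fun e _ => ?_
    have he := hf.1 e
    split_ifs with h2 h1
    · have : e = (s, t) := Prod.ext h1 h2
      simp [this, h0]
    all_goals linarith
  linarith

/-- Routing every demand of `trafficTE` along its own edge uses each edge exactly to capacity. -/
lemma routable_trafficTE (hcap : ∀ e ∈ E, 0 < cap e) :
    Routable E cap (trafficTE E cap) E := by
  refine ⟨fun p e => if e = p then trafficTE E cap p else 0, fun p => ⟨fun e => ?_,
    fun e he => ?_, fun v => ?_⟩, fun e he => ?_, fun e he hne => absurd he hne⟩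
  · dsimp only [trafficTE]
    split_ifs with _ hp
    · exact (hcap p hp).le
    all_goals exact le_rfl
  · dsimp only [trafficTE]
    split_ifs with h hp
    · exact absurd (h ▸ hp) he
    all_goals rfl
  · rw [Finset.sum_ite_eq', Finset.sum_ite_eq']
    by_cases hp : p ∈ E <;> simp [trafficTE, hp, eq_comm]
  · simp [trafficTE, he]

/-- The edges dropped by a feasible solution have bounded total capacity. -/
lemma MMCFSFeasible.sum_cap_sdiff_le (hE : ∀ e ∈ E, e.1 ≠ e.2) (hcap : ∀ e ∈ E, 0 < cap e)
    {α : ℚ} {O : Finset (V × V)} (hO : MMCFSFeasible E cap α O) :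
    2 * α * ∑ e ∈ E \ O, cap e ≤ (1 - α) * ∑ e ∈ O, cap e := by
  have hT : IsTrafficMatrix (trafficTE E cap) := fun p => by
    dsimp only [trafficTE]
    split_ifs with hp
    · exact (hcap p hp).le
    · exact le_rfl
  obtain ⟨f, hf, hfcap, hfO⟩ := hO.2 _ hT (routable_trafficTE hcap)
  have hval : ∀ p ∈ E, α * trafficTE E cap p = α * cap p := fun p hp => by
    rw [trafficTE, if_pos hp]
  have hzero : ∀ p, ∀ e ∈ E \ O, f p e = 0 := fun p e he => by
    rw [Finset.mem_sdiff] at he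
    exact (Finset.sum_eq_zero_iff_of_nonneg fun q _ => (hf q).1 e).1 (hfO e he.1 he.2) p
      (Finset.mem_univ p)
  have hupper : ∑ p ∈ E, ∑ e ∈ E, f p e ≤ ∑ e ∈ O, cap e := by
    calc ∑ p ∈ E, ∑ e ∈ E, f p e
        ≤ ∑ p, ∑ e ∈ E, f p e :=
          Finset.sum_le_sum_of_subset_of_nonneg (Finset.subset_univ _) fun p _ _ =>
            (hf p).sum_nonneg E
      _ = ∑ e ∈ E, ∑ p, f p e := Finset.sum_comm
      _ = ∑ e ∈ O, ∑ p, f p e :=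
          (Finset.sum_subset hO.1 fun e he hne => hfO e he hne).symm
      _ ≤ ∑ e ∈ O, cap e := Finset.sum_le_sum fun e he => hfcap e (hO.1 he)
  have hdropped : ∑ p ∈ E \ O, 2 * (α * cap p) ≤ ∑ p ∈ E \ O, ∑ e ∈ E, f p e :=
    Finset.sum_le_sum fun p hp => by
      have hpE := (Finset.mem_sdiff.1 hp).1
      rw [← hval p hpE]
      exact (hf p).two_mul_le_sum (hE p hpE) (hzero p p hp)
  have hkept : ∑ p ∈ O, α * cap p ≤ ∑ p ∈ O, ∑ e ∈ E, f p e :=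
    Finset.sum_le_sum fun p hp => by
      rw [← hval p (hO.1 hp)]
      exact (hf p).le_sum (hE p (hO.1 hp))
  rw [← Finset.sum_sdiff hO.1] at hupper
  simp only [← Finset.mul_sum] at hdropped hkept
  linarith

end

lemma meanCap_mul_card (cap : V × V → ℚ) (S : Finset (V × V)) :
    meanCap cap S * S.card = ∑ e ∈ S, cap e := by
  rcases S.eq_empty_or_nonempty with rfl | hS
  · simp
  · exact div_mul_cancel₀ _ (Nat.cast_ne_zero.2 hS.card_pos.ne')

lemma meanCap_pos {cap : V × V → ℚ} {S : Finset (V × V)} (hS : S.Nonempty)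
    (hcap : ∀ e ∈ S, 0 < cap e) : 0 < meanCap cap S :=
  div_pos (Finset.sum_pos hcap hS) (Nat.cast_pos.2 hS.card_pos)

/-- A bound on total capacity translates into a bound on cardinality via mean capacities. -/
lemma card_le_of_sum_cap_le {cap : V × V → ℚ} {S O : Finset (V × V)} {c : ℚ}
    (hS : S.Nonempty) (hcap : ∀ e ∈ S, 0 < cap e)
    (h : ∑ e ∈ S, cap e ≤ c * ∑ e ∈ O, cap e) :
    (S.card : ℚ) ≤ c * (meanCap cap O / meanCap cap S) * O.card := by
  rw [← meanCap_mul_card, ← meanCap_mul_card] at h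
  have hpos := meanCap_pos hS hcap
  rw [show c * (meanCap cap O / meanCap cap S) * O.card
    = c * (meanCap cap O * O.card) / meanCap cap S by ring, le_div_iff₀ hpos, mul_comm]
  exact h

theorem stmt2 [Fintype V] [DecidableEq V] (E : Finset (V × V))
    (hE : ∀ e ∈ E, e.1 ≠ e.2) (cap : V × V → ℚ) (hcap : ∀ e ∈ E, 0 < cap e)
    (α : ℚ) (h0 : 0 < α) (h1 : α < 1) (O A : Finset (V × V))
    (hOfeas : MMCFSFeasible E cap α O)
    (hOopt : ∀ B : Finset (V × V), MMCFSFeasible E cap α B → O.card ≤ B.card)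
    (hAfeas : MMCFSFeasible E cap α A) (hne : A ≠ O) :
    (A \ O).Nonempty ∧
      (A.card : ℚ) ≤ (1 + (1 - α) / (2 * α)) * (meanCap cap O / meanCap cap A) * O.card ∧
      (A.card : ℚ) ≤
        O.card + (1 - α) / (2 * α) * (meanCap cap O / meanCap cap (A \ O)) * O.card := by
  have hdiff : (A \ O).Nonempty := by
    rw [Finset.sdiff_nonempty]
    exact fun hsub => hne (Finset.eq_of_subset_of_card_le hsub (hOopt A hAfeas))
  have hcapA : ∀ e ∈ A, 0 < cap e := fun e he => hcap e (hAfeas.1 he)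
  have hnew : ∑ e ∈ A \ O, cap e ≤ (1 - α) / (2 * α) * ∑ e ∈ O, cap e := by
    have hsub : ∑ e ∈ A \ O, cap e ≤ ∑ e ∈ E \ O, cap e :=
      Finset.sum_le_sum_of_subset_of_nonneg (Finset.sdiff_subset_sdiff hAfeas.1 le_rfl)
        fun e he _ => (hcap e (Finset.mem_sdiff.1 he).1).le
    refine hsub.trans ?_
    rw [div_mul_eq_mul_div, le_div_iff₀ (by positivity), mul_comm]
    exact hOfeas.sum_cap_sdiff_le hE hcap
  refine ⟨hdiff, card_le_of_sum_cap_le (hdiff.mono Finset.sdiff_subset) hcapA ?_, ?_⟩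
  · have hinter : ∑ e ∈ A ∩ O, cap e ≤ ∑ e ∈ O, cap e :=
      Finset.sum_le_sum_of_subset_of_nonneg Finset.inter_subset_right
        fun e he _ => (hcap e (hOfeas.1 he)).le
    rw [← Finset.sum_inter_add_sum_sdiff A O]
    linarith
  · have hcard : (A.card : ℚ) ≤ O.card + (A \ O).card := by
      exact_mod_cast (Finset.card_le_card_sdiff_add_card (s := A) (t := O)).trans_eq (add_comm _ _)
    have := card_le_of_sum_cap_le hdiff (fun e he => hcapA e (Finset.sdiff_subset he)) hnew
    linarith
end

section
/- For every integer q ≥ 2 and α = 1/q, there exist a digraph G=(V,E) with positive capacities cap and a basic optimal solution (x*, f*) of the LP feasible region P for (G,cap,α) such that |{e ∈ E : x*(e) > 0}| = (1/α)·m, where m is the minimum cardinality of a set A ⊆ E in which the scaled matrix α·T_E is routable. -/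
open Finset

variable {V : Type*}

/-- The LP feasible region `P` for `(G, cap, α)`: pairs `(x, f)` where each commodity
`k ∈ E` routes a flow of value `α · cap k` and the total flow on each edge `e` is at
most `x e · cap e`, with `0 ≤ x e ≤ 1`. Coordinates outside `E` are fixed to `0`. -/
def LPRegion [Fintype V] [DecidableEq V] (E : Finset (V × V)) (cap : V × V → ℚ)
    (α : ℚ) : Set ((V × V → ℚ) × (V × V → V × V → ℚ)) :=
  {p | (∀ k, k ∉ E → p.2 k = 0) ∧
       (∀ k ∈ E, IsFlow E k.1 k.2 (α * cap k) (p.2 k)) ∧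
       (∀ e ∈ E, (∑ k ∈ E, p.2 k e) ≤ p.1 e * cap e) ∧
       (∀ e ∈ E, 0 ≤ p.1 e ∧ p.1 e ≤ 1) ∧
       (∀ e, e ∉ E → p.1 e = 0)}

/-- A basic optimal solution of the LP: an extreme point of the feasible region
minimizing `∑ e ∈ E, x e`. -/
def BasicOptimal [Fintype V] [DecidableEq V] (E : Finset (V × V)) (cap : V × V → ℚ)
    (α : ℚ) (p : (V × V → ℚ) × (V × V → V × V → ℚ)) : Prop :=
  p ∈ Set.extremePoints ℚ (LPRegion E cap α) ∧
    ∀ q ∈ LPRegion E cap α, (∑ e ∈ E, p.1 e) ≤ ∑ e ∈ E, q.1 e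

theorem IsFlow.sum_mul_potential_sub [Fintype V] [DecidableEq V] {E : Finset (V × V)} {s t : V}
    {d : ℚ} {f : V × V → ℚ} (hf : IsFlow E s t d f) (φ : V → ℚ) :
    ∑ e ∈ E, f e * (φ e.2 - φ e.1) = d * (φ t - φ s) := by
  have key : ∀ g : V × V → V,
      ∑ e ∈ E, f e * φ (g e) = ∑ v, φ v * ∑ e ∈ E.filter (fun e => g e = v), f e := by
    intro g
    rw [← Finset.sum_fiberwise E g]
    refine Finset.sum_congr rfl fun v _ => ?_
    rw [Finset.mul_sum]
    refine Finset.sum_congr rfl fun e he => ?_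
    rw [(Finset.mem_filter.mp he).2, mul_comm]
  simp only [mul_sub, Finset.sum_sub_distrib]
  rw [key Prod.snd, key Prod.fst, ← Finset.sum_sub_distrib]
  simp only [← mul_sub, hf.2.2]
  simp only [mul_sub, Finset.sum_sub_distrib, mul_ite, mul_zero, Finset.sum_ite_eq',
    Finset.mem_univ, if_true]
  ring

theorem isFlow_single [Fintype V] [DecidableEq V] {E : Finset (V × V)} {k : V × V} (hk : k ∈ E)
    {d : ℚ} (hd : 0 ≤ d) : IsFlow E k.1 k.2 d (Pi.single k d) := by
  refine ⟨fun e => ?_, fun e he => ?_, fun v => ?_⟩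
  · by_cases h : e = k
    · subst h; simpa using hd
    · simp [h]
  · exact Pi.single_eq_of_ne (ne_of_mem_of_not_mem hk he).symm _
  · simp only [Finset.sum_pi_single', Finset.mem_filter, hk, true_and, eq_comm]

/-- Routing every demand on its own edge is an extreme point of the feasible region. -/
theorem direct_mem_extremePoints [Fintype V] [DecidableEq V] {E : Finset (V × V)}
    {cap : V × V → ℚ} {α : ℚ} (hne : ∀ e ∈ E, e.1 ≠ e.2)
    (hcap : ∀ e ∈ E, 0 < cap e) (h0 : 0 ≤ α) (h1 : α ≤ 1) :
    ((fun e => if e ∈ E then α else 0,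
      fun k => if k ∈ E then Pi.single k (α * cap k) else 0) :
        (V × V → ℚ) × (V × V → V × V → ℚ)) ∈ Set.extremePoints ℚ (LPRegion E cap α) := by
  have hle : ∀ e ∈ E, ∑ k ∈ E, (if k ∈ E then (Pi.single k (α * cap k) : V × V → ℚ) else 0) e =
      α * cap e := fun e he => by
    rw [Finset.sum_eq_single_of_mem e he fun k hk hne => by simp [hk, hne.symm]]
    simp [he]
  refine mem_extremePoints_iff_left.mpr ⟨⟨fun k hk => if_neg hk, fun k hk => ?_, fun e he => ?_,
    fun e he => ?_, fun e he => if_neg he⟩, ?_⟩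
  · simp only [hk, if_true]
    exact isFlow_single hk (mul_nonneg h0 (hcap k hk).le)
  · exact ((hle e he).trans (by simp [he])).le
  · simp [he, h0, h1]
  rintro ⟨x, f⟩ ⟨hf0, hf, hx, -, hx0⟩ ⟨y, g⟩ ⟨hg0, hg, hy, -, hy0⟩ ⟨a, b, ha, hb, hab, h⟩
  dsimp only at hf0 hf hx hx0 hg0 hg hy hy0
  have hfst := congrArg Prod.fst h
  have hsnd := congrArg Prod.snd h
  have hoff : ∀ k ∈ E, ∀ e, e ≠ k → f k e = 0 ∧ g k e = 0 := fun k hk e hne => by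
    have hke := congrFun (congrFun hsnd k) e
    simp only [hk, if_true, Pi.single_eq_of_ne hne, Prod.snd_add, Prod.smul_snd, Pi.add_apply,
      Pi.smul_apply, smul_eq_mul] at hke
    have h1 := (hf k hk).1 e
    have h2 := (hg k hk).1 e
    constructor <;> nlinarith [mul_nonneg ha.le h1, mul_nonneg hb.le h2]
  have heq : ∀ k ∈ E, ∀ u : V × V → ℚ, IsFlow E k.1 k.2 (α * cap k) u →
      (∀ e, e ≠ k → u e = 0) → u k = α * cap k := fun k hk u hu hu0 => by
    have hv := hu.sum_mul_potential_sub fun v => if v = k.2 then 1 else 0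
    rw [Finset.sum_eq_single_of_mem k hk fun e _ hne => by simp [hu0 e hne]] at hv
    simpa [(hne k hk)] using hv
  have hload : ∀ u : V × V → V × V → ℚ, (∀ k ∈ E, IsFlow E k.1 k.2 (α * cap k) (u k)) →
      (∀ k ∈ E, ∀ e, e ≠ k → u k e = 0) → ∀ z : V × V → ℚ,
      (∀ e ∈ E, ∑ k ∈ E, u k e ≤ z e * cap e) → ∀ e ∈ E, α ≤ z e := by
    intro u hu hu0 z hz e he
    have hze := hz e he
    rw [Finset.sum_eq_single_of_mem e he fun k hk hne => hu0 k hk e hne.symm,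
      heq e he _ (hu e he) (hu0 e he)] at hze
    exact le_of_mul_le_mul_right hze (hcap e he)
  refine Prod.ext (funext fun e => ?_) (funext fun k => ?_)
  · by_cases he : e ∈ E
    · have hxe := hload f hf (fun k hk e hne => (hoff k hk e hne).1) x hx e he
      have hye := hload g hg (fun k hk e hne => (hoff k hk e hne).2) y hy e he
      have hae := congrFun hfst e
      simp only [he, if_true, Prod.fst_add, Prod.smul_fst, Pi.add_apply,
        Pi.smul_apply, smul_eq_mul] at hae ⊢
      obtain rfl : b = 1 - a := by linarith
      nlinarith
    · simp [he, hx0]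
  · by_cases hk : k ∈ E
    · simp only [hk, if_true]
      funext e
      by_cases hek : e = k
      · subst hek
        simpa using heq e hk _ (hf e hk) fun e' hne => (hoff e hk e' hne).1
      · simpa [hek] using (hoff k hk e hek).1
    · simp [hk, hf0]

/-- The length of the arc from `e.1` to `e.2` on the directed cycle `Fin (q + 1)`. -/
def arcLength {q : ℕ} (e : Fin (q + 1) × Fin (q + 1)) : ℕ := (e.2 - e.1).val

theorem ne_add_one_of_pos {q : ℕ} (hq : 0 < q) (i : Fin (q + 1)) : i ≠ i + 1 := fun h => by
  have h1 : (1 : Fin (q + 1)) = 0 := by simpa using h.symm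
  have := congrArg Fin.val h1
  rw [Fin.val_one', Nat.mod_eq_of_lt (by omega)] at this
  simp at this

theorem arcLength_pos {q : ℕ} {e : Fin (q + 1) × Fin (q + 1)} (h : e.1 ≠ e.2) :
    0 < arcLength e := by
  have h' : e.2 - e.1 ≠ 0 := sub_ne_zero.mpr h.symm
  exact Nat.pos_of_ne_zero fun h0 => h' (Fin.ext h0)

theorem arcLength_le_add {q : ℕ} (u v w : Fin (q + 1)) :
    arcLength (u, w) ≤ arcLength (u, v) + arcLength (v, w) := by
  have h : w - u = (v - u) + (w - v) := by abel
  simp only [arcLength, h, Fin.val_add]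
  exact Nat.mod_le _ _

/-- The flow of value `d` along the directed cycle from `s` to `t`. -/
def cycleFlow {q : ℕ} (s t : Fin (q + 1)) (d : ℚ) (e : Fin (q + 1) × Fin (q + 1)) : ℚ :=
  if e.2 = e.1 + 1 ∧ arcLength (s, e.1) < arcLength (s, t) then d else 0

theorem isFlow_cycleFlow {q : ℕ} (hq : 0 < q) (s t : Fin (q + 1)) {d : ℚ} (hd : 0 ≤ d) :
    IsFlow univ.offDiag s t d (cycleFlow s t d) := by
  have hne : ∀ i : Fin (q + 1), i ≠ i + 1 := ne_add_one_of_pos hq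
  have hin : ∀ v, ∑ e ∈ univ.offDiag.filter (fun e : Fin (q + 1) × Fin (q + 1) => e.2 = v),
      cycleFlow s t d e = if arcLength (s, v - 1) < arcLength (s, t) then d else 0 := fun v => by
    have hv : v - 1 ≠ v := fun h => hne (v - 1) (by rw [sub_add_cancel]; exact h)
    rw [Finset.sum_eq_single_of_mem (v - 1, v) (by simp [hv])]
    · simp [cycleFlow]
    · rintro ⟨i, j⟩ hij hne'
      simp only [Finset.mem_filter] at hij
      obtain ⟨-, rfl⟩ := hij
      exact if_neg fun h => hne' (Prod.ext (eq_sub_of_add_eq h.1.symm) rfl)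
  have hout : ∀ v, ∑ e ∈ univ.offDiag.filter (fun e : Fin (q + 1) × Fin (q + 1) => e.1 = v),
      cycleFlow s t d e = if arcLength (s, v) < arcLength (s, t) then d else 0 := fun v => by
    rw [Finset.sum_eq_single_of_mem (v, v + 1) (by simp [hne v])]
    · simp [cycleFlow]
    · rintro ⟨i, j⟩ hij hne'
      simp only [Finset.mem_filter] at hij
      obtain ⟨-, rfl⟩ := hij
      exact if_neg fun h => hne' (Prod.ext rfl h.1)
  refine ⟨fun e => ?_, fun e he => if_neg fun h => he ?_, fun v => ?_⟩
  · unfold cycleFlow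
    split_ifs
    exacts [hd, le_rfl]
  · simpa [h.1] using hne e.1
  · rw [hin, hout]
    have hlt : arcLength (s, t) < q + 1 := (t - s).isLt
    have hvt : v = t ↔ arcLength (s, v) = arcLength (s, t) := by
      simp [arcLength, Fin.val_inj]
    by_cases hvs : v = s
    · subst hvs
      have h1 : arcLength (v, v - 1) = q := by
        simp [arcLength, Fin.coe_neg_one]
      have h2 : arcLength (v, v) = 0 := by simp [arcLength]
      rw [h1, h2, if_neg (by omega), if_pos rfl]
      simp only [hvt, h2]
      split_ifs <;> first | omega | ring
    · have h1 : arcLength (s, v - 1) + 1 = arcLength (s, v) := by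
        have h0 : v - s ≠ 0 := sub_ne_zero.mpr hvs
        have hs : v - 1 - s = v - s - 1 := by abel
        have hp := arcLength_pos (e := (s, v)) (Ne.symm hvs)
        simp only [arcLength, hs, Fin.val_sub_one_of_ne_zero h0] at hp ⊢
        omega
      rw [if_neg hvs]
      simp only [hvt]
      split_ifs <;> first | omega | ring

theorem sum_cycleFlow {q : ℕ} (α : ℚ) (i : Fin (q + 1)) :
    ∑ p : Fin (q + 1) × Fin (q + 1),
      cycleFlow p.1 p.2 (α * (1 / (arcLength p : ℚ))) (i, i + 1) = q * α := by
  have hshift : ∀ s b : Fin (q + 1), arcLength (s, s + b) = b.val := fun s b => by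
    simp [arcLength]
  calc _ = ∑ a : Fin (q + 1), ∑ b : Fin (q + 1),
        if a.val < b.val then α * (1 / (b.val : ℚ)) else 0 := by
        rw [Fintype.sum_prod_type, ← Equiv.sum_comp (Equiv.subLeft i)]
        refine Finset.sum_congr rfl fun a _ => ?_
        rw [← Equiv.sum_comp (Equiv.addLeft (i - a))]
        refine Finset.sum_congr rfl fun b _ => ?_
        have ha : arcLength (i - a, i) = a.val := by simp [arcLength]
        simp only [cycleFlow, Equiv.subLeft_apply, Equiv.coe_addLeft, hshift, ha, true_and]
    _ = ∑ b : Fin (q + 1), (b.val : ℚ) * (α * (1 / (b.val : ℚ))) := by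
        rw [Finset.sum_comm]
        refine Finset.sum_congr rfl fun b _ => ?_
        have hcard : (univ.filter fun a : Fin (q + 1) => a.val < b.val).card = b.val :=
          (congrArg Finset.card (by ext; simp)).trans (Fin.card_Iio b)
        rw [← Finset.sum_filter, Finset.sum_const, hcard, nsmul_eq_mul]
    _ = q * α := by
        have hb : ∀ b : Fin q, ((b.succ.val : ℕ) : ℚ) * (α * (1 / (b.succ.val : ℚ))) = α :=
          fun b => by
            have : ((b.succ.val : ℕ) : ℚ) ≠ 0 := by simp [Nat.cast_add_one_ne_zero]
            field_simp
        rw [Fin.sum_univ_succ]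
        simp only [hb]
        simp

theorem card_le_of_routable [Fintype V] [DecidableEq V] {E : Finset (V × V)} {cap T : V × V → ℚ}
    {A : Finset (V × V)} (hA : Routable E cap T A) (hT : ∀ s, ∃ t, s ≠ t ∧ 0 < T (s, t)) :
    Fintype.card V ≤ A.card := by
  obtain ⟨f, hf, -, hzero⟩ := hA
  have hsurj : A.image Prod.fst = univ := by
    refine Finset.eq_univ_of_forall fun s => ?_
    obtain ⟨t, hst, hT⟩ := hT s
    by_contra hs
    have hout : ∑ e ∈ E.filter (fun e => e.1 = s), f (s, t) e = 0 := by
      refine Finset.sum_eq_zero fun e he => ?_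
      obtain ⟨heE, hes⟩ := Finset.mem_filter.mp he
      have heA : e ∉ A := fun h => hs (hes ▸ Finset.mem_image_of_mem Prod.fst h)
      exact (Finset.sum_eq_zero_iff_of_nonneg fun p _ => (hf p).1 e).mp
        (hzero e heE heA) _ (Finset.mem_univ _)
    have hin : 0 ≤ ∑ e ∈ E.filter (fun e => e.2 = s), f (s, t) e :=
      Finset.sum_nonneg fun e _ => (hf (s, t)).1 e
    have hv := (hf (s, t)).2.2 s
    simp only [hout, hst, if_true, if_false] at hv
    linarith
  calc Fintype.card V = (A.image Prod.fst).card := by rw [hsurj, Finset.card_univ]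
    _ ≤ A.card := Finset.card_image_le

theorem stmt14 (q : ℕ) (hq : 2 ≤ q) (α : ℚ) (hα : α = 1 / (q : ℚ)) :
    ∃ (n : ℕ) (E : Finset (Fin n × Fin n)) (cap : Fin n × Fin n → ℚ),
      (∀ e ∈ E, e.1 ≠ e.2) ∧ (∀ e ∈ E, 0 < cap e) ∧
      ∃ (x : Fin n × Fin n → ℚ) (f : Fin n × Fin n → Fin n × Fin n → ℚ) (m : ℕ),
        BasicOptimal E cap α (x, f) ∧
        IsLeast {c : ℕ | ∃ A ⊆ E,
          Routable E cap (fun p => α * trafficTE E cap p) A ∧ A.card = c} m ∧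
        ((E.filter fun e => 0 < x e).card : ℚ) = (1 / α) * (m : ℚ) := by
  have hq0 : (0 : ℚ) < q := by exact_mod_cast (by omega : 0 < q)
  have hα0 : 0 < α := by rw [hα]; positivity
  have hα1 : α ≤ 1 := by
    rw [hα, div_le_one hq0]
    exact_mod_cast (by omega : 1 ≤ q)
  have hmem : ∀ e : Fin (q + 1) × Fin (q + 1), e ∈ (univ.offDiag : Finset _) ↔ e.1 ≠ e.2 := by
    simp [Finset.mem_offDiag]
  have hcap : ∀ e ∈ (univ.offDiag : Finset (Fin (q + 1) × Fin (q + 1))),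
      (0 : ℚ) < 1 / (arcLength e : ℚ) := fun e he => by
    have : (0 : ℚ) < arcLength e := by exact_mod_cast arcLength_pos ((hmem e).mp he)
    positivity
  have hsucc : ∀ i : Fin (q + 1), i ≠ i + 1 := ne_add_one_of_pos (by omega)
  refine ⟨q + 1, univ.offDiag, fun e => 1 / (arcLength e : ℚ), fun e he => (hmem e).mp he, hcap,
    _, _, q + 1, ⟨direct_mem_extremePoints (fun e he => (hmem e).mp he) hcap hα0.le hα1, ?_⟩, ⟨?_, ?_⟩, ?_⟩
  · rintro ⟨x, f⟩ ⟨-, hflow, hload, -, -⟩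
    dsimp only at hflow hload ⊢
    have hx : ∀ e ∈ (univ.offDiag : Finset (Fin (q + 1) × Fin (q + 1))),
        ∑ k ∈ univ.offDiag, f k e * arcLength e ≤ x e := fun e he => by
      have hpos : (0 : ℚ) < arcLength e := by exact_mod_cast arcLength_pos ((hmem e).mp he)
      have := mul_le_mul_of_nonneg_right (hload e he) hpos.le
      rw [Finset.sum_mul] at this
      refine this.trans_eq ?_
      field_simp
    calc ∑ e ∈ univ.offDiag, (if e ∈ univ.offDiag then α else 0)
        = ∑ e ∈ univ.offDiag, α := Finset.sum_congr rfl fun e he => if_pos he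
      _ ≤ ∑ k ∈ univ.offDiag, ∑ e ∈ univ.offDiag, f k e * arcLength e := by
          refine Finset.sum_le_sum fun k hk => ?_
          have hpos : (0 : ℚ) < arcLength k := by exact_mod_cast arcLength_pos ((hmem k).mp hk)
          have hpot := (hflow k hk).sum_mul_potential_sub fun v => (arcLength (k.1, v) : ℚ)
          have hval : α * (1 / (arcLength k : ℚ)) *
              ((arcLength (k.1, k.2) : ℚ) - (arcLength (k.1, k.1) : ℚ)) = α := by
            have : arcLength (k.1, k.1) = 0 := by simp [arcLength]
            rw [this]
            field_simp
            simp
          rw [hval] at hpot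
          rw [← hpot]
          refine Finset.sum_le_sum fun e _ => mul_le_mul_of_nonneg_left ?_ ((hflow k hk).1 e)
          have : (arcLength (k.1, e.2) : ℚ) ≤ arcLength (k.1, e.1) + arcLength (e.1, e.2) := by
            exact_mod_cast arcLength_le_add k.1 e.1 e.2
          linarith
      _ = ∑ e ∈ univ.offDiag, ∑ k ∈ univ.offDiag, f k e * arcLength e := Finset.sum_comm
      _ ≤ ∑ e ∈ univ.offDiag, x e := Finset.sum_le_sum hx
  · have htraffic : ∀ p : Fin (q + 1) × Fin (q + 1),
        trafficTE univ.offDiag (fun e => 1 / (arcLength e : ℚ)) p = 1 / (arcLength p : ℚ) := by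
      intro p
      by_cases hp : p.1 = p.2
      · simp [trafficTE, hmem, hp, arcLength]
      · simp [trafficTE, hmem, hp]
    refine ⟨univ.image fun i => (i, i + 1), ?_,
      ⟨fun p => cycleFlow p.1 p.2 (α * (1 / (arcLength p : ℚ))), fun p => ?_, ?_, ?_⟩, ?_⟩
    · intro e he
      obtain ⟨i, -, rfl⟩ := Finset.mem_image.mp he
      exact (hmem _).mpr (hsucc i)
    · simp only [htraffic]
      exact isFlow_cycleFlow (by omega) _ _ (by positivity)
    · rintro ⟨i, j⟩ he
      by_cases hj : j = i + 1
      · subst hj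
        have h1 : arcLength (i, i + 1) = 1 := by
          simp [arcLength, Nat.mod_eq_of_lt (by omega : 1 < q + 1)]
        simp only [sum_cycleFlow, hα, h1]
        field_simp
        simp
      · have hz : ∀ p : Fin (q + 1) × Fin (q + 1),
            cycleFlow p.1 p.2 (α * (1 / (arcLength p : ℚ))) (i, j) = 0 := by
          simp [cycleFlow, hj]
        simp only [hz, Finset.sum_const_zero]
        exact (hcap _ he).le
    · rintro ⟨i, j⟩ - hA
      refine Finset.sum_eq_zero fun p _ => if_neg fun h => hA ?_
      exact Finset.mem_image.mpr ⟨i, Finset.mem_univ _, Prod.ext rfl h.1.symm⟩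
    · rw [Finset.card_image_of_injective _ fun i j h => (Prod.ext_iff.mp h).1]
      simp
  · rintro c ⟨A, -, hA, rfl⟩
    have := card_le_of_routable hA fun s => ⟨s + 1, hsucc s, by
      have hE : (s, s + 1) ∈ (univ.offDiag : Finset _) := (hmem _).mpr (hsucc s)
      simp only [trafficTE, hE, if_true]
      exact mul_pos hα0 (hcap _ hE)⟩
    simpa using this
  · have hfilter : (univ.offDiag.filter fun e : Fin (q + 1) × Fin (q + 1) =>
        0 < if e ∈ univ.offDiag then α else 0) = univ.offDiag :=
      Finset.filter_true_of_mem fun e he => by rw [if_pos he]; exact hα0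
    have hcard : (univ.offDiag : Finset (Fin (q + 1) × Fin (q + 1))).card = q * (q + 1) := by
      rw [Finset.offDiag_card, Finset.card_univ, Fintype.card_fin, ← Nat.sub_one_mul]
      simp
    rw [hfilter, hcard, hα]
    push_cast
    field_simp
end
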